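/- Let 1/2 ≤ m < m'. Let X, Y be independent Gamma random variables each with shape m and scale 1/m, and let X', Y' be independent Gamma random variables each with shape m' and scale 1/m' (so all four have mean 1). Then P(X·Y > γ) / P(X'·Y' > γ) → ∞ as γ → ∞. -/

import Mathlib

open MeasureTheory ProbabilityTheory Filter Set Topology

/-- Gamma density with shape `m` and scale `θ`. -/
noncomputable def gammaDen (m θ z : ℝ) : ℝ :=
  if 0 < z then z ^ (m - 1) * Real.exp (-z / θ) / (Real.Gamma m * θ ^ m) else 0

theorem measurable_gammaDen (m θ : ℝ) : Measurable (gammaDen m θ) :=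
  Measurable.ite measurableSet_Ioi (by fun_prop) measurable_const

theorem gammaDen_nonneg {m θ : ℝ} (hm : 0 < m) (hθ : 0 < θ) (z : ℝ) : 0 ≤ gammaDen m θ z := by
  unfold gammaDen
  have := Real.Gamma_pos_of_pos hm
  split_ifs <;> positivity

/-- Exponential lower bound on `[1, ∞)` for the Gamma density of rate `m`, nontrivial when `m < a`. -/
theorem le_gammaDen {m a z : ℝ} (hm : 0 < m) (hz : 1 ≤ z) :
    (a - m) / (Real.Gamma m * (1 / m) ^ m) * Real.exp (-(a * z)) ≤ gammaDen m (1 / m) z := by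
  have hz0 : 0 < z := by linarith
  have hG := Real.Gamma_pos_of_pos hm
  have hpow : (a - m) * Real.exp (-((a - m) * z)) ≤ z ^ (m - 1) := calc
    (a - m) * Real.exp (-((a - m) * z)) ≤ z ^ (-1 : ℝ) := by
      rw [Real.rpow_neg_one, Real.exp_neg, ← div_eq_mul_inv, div_le_iff₀ (Real.exp_pos _),
        inv_mul_eq_div, le_div_iff₀ hz0]
      linarith [Real.add_one_le_exp ((a - m) * z)]
    _ ≤ z ^ (m - 1) := Real.rpow_le_rpow_of_exponent_le hz (by linarith)
  rw [gammaDen, if_pos hz0, div_mul_eq_mul_div]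
  refine div_le_div_of_nonneg_right ?_ (by positivity)
  calc (a - m) * Real.exp (-(a * z))
      = (a - m) * Real.exp (-((a - m) * z)) * Real.exp (-z / (1 / m)) := by
        rw [mul_assoc, ← Real.exp_add]
        congr 2
        field_simp
        ring
    _ ≤ z ^ (m - 1) * Real.exp (-z / (1 / m)) := by gcongr

section GammaLaw

variable {Ω : Type*} [MeasurableSpace Ω] {μ : Measure Ω} {m : ℝ}

theorem ae_pos_of_gammaLaw {θ : ℝ} {X : Ω → ℝ} (hX : Measurable X)
    (hlaw : μ.map X = volume.withDensity (fun z => ENNReal.ofReal (gammaDen m θ z))) :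
    ∀ᵐ ω ∂μ, 0 < X ω := by
  refine ae_of_ae_map (p := fun z => 0 < z) hX.aemeasurable ?_
  rw [hlaw, ae_withDensity_iff (measurable_gammaDen m θ).ennreal_ofReal]
  refine ae_of_all _ fun z hz => ?_
  by_contra h
  simp [gammaDen, h] at hz

theorem integrable_exp_mul_of_gammaLaw {X : Ω → ℝ} {s : ℝ} (hm : 0 < m) (hs : s < m)
    (hX : Measurable X)
    (hlaw : μ.map X = volume.withDensity (fun z => ENNReal.ofReal (gammaDen m (1 / m) z))) :
    Integrable (fun ω => Real.exp (s * X ω)) μ := by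
  have hexp : Integrable (fun z => Real.exp (s * z)) (μ.map X) := by
    rw [hlaw, integrable_withDensity_iff_integrable_smul'
      (measurable_gammaDen m (1 / m)).ennreal_ofReal (ae_of_all _ fun _ => ENNReal.ofReal_lt_top)]
    have hint := (integrableOn_rpow_mul_exp_neg_mul_rpow (p := 1) (s := m - 1) (b := m - s)
      (by linarith) one_pos (by linarith)).const_mul (Real.Gamma m * (1 / m) ^ m)⁻¹
    refine ((integrable_indicator_iff measurableSet_Ioi).2 hint).congr (ae_of_all _ fun z => ?_)
    dsimp only
    rw [ENNReal.toReal_ofReal (gammaDen_nonneg hm (by positivity) z), gammaDen, indicator_apply]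
    simp only [mem_Ioi]
    split_ifs
    · have hsplit : -(m - s) * z ^ (1 : ℝ) = -z / (1 / m) + s * z := by
        rw [Real.rpow_one]
        field_simp
        ring
      rw [hsplit, Real.exp_add, smul_eq_mul]
      ring
    · simp
  exact hexp.comp_measurable hX

variable [IsProbabilityMeasure μ]

theorem exists_exp_le_tail_of_gammaLaw {a : ℝ} (hm : 0 < m) (ha : m < a) :
    ∃ c > 0, ∀ X : Ω → ℝ, Measurable X →
      μ.map X = volume.withDensity (fun z => ENNReal.ofReal (gammaDen m (1 / m) z)) →
      ∀ t, 1 ≤ t → c * Real.exp (-(a * t)) ≤ μ.real {ω | t < X ω} := by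
  have hG := Real.Gamma_pos_of_pos hm
  have ham : 0 < a - m := by linarith
  refine ⟨(a - m) / (Real.Gamma m * (1 / m) ^ m) * Real.exp (-a), by positivity,
    fun X hX hlaw t ht => ?_⟩
  set K := (a - m) / (Real.Gamma m * (1 / m) ^ m)
  have hK0 : 0 < K := by positivity
  have hmap : μ {ω | t < X ω} = μ.map X (Ioi t) := (Measure.map_apply hX measurableSet_Ioi).symm
  rw [measureReal_def, ← ENNReal.ofReal_le_iff_le_toReal (measure_ne_top _ _), hmap, hlaw,
    withDensity_apply _ measurableSet_Ioi]
  calc ENNReal.ofReal (K * Real.exp (-a) * Real.exp (-(a * t)))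
      = ∫⁻ _ in Ioc t (t + 1), ENNReal.ofReal (K * Real.exp (-(a * (t + 1)))) := by
        rw [setLIntegral_const, Real.volume_Ioc, add_sub_cancel_left, ENNReal.ofReal_one, mul_one,
          mul_assoc, ← Real.exp_add]
        congr 3
        ring
    _ ≤ ∫⁻ z in Ioc t (t + 1), ENNReal.ofReal (gammaDen m (1 / m) z) := by
        refine setLIntegral_mono' measurableSet_Ioc fun z hz => ENNReal.ofReal_le_ofReal ?_
        refine le_trans ?_ (le_gammaDen (a := a) hm (ht.trans hz.1.le))
        have ha0 : 0 ≤ a := by linarith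
        have := hz.2
        gcongr
    _ ≤ ∫⁻ z in Ioi t, ENNReal.ofReal (gammaDen m (1 / m) z) :=
        lintegral_mono_set Ioc_subset_Ioi_self

/-- Chernoff bound for the product, through `2 √(X Y) ≤ X + Y`. -/
theorem exists_tail_mul_le_of_gammaLaw {X Y : Ω → ℝ} {s : ℝ} (hs0 : 0 ≤ s) (hs : s < m)
    (hX : Measurable X) (hY : Measurable Y) (hindep : IndepFun X Y μ)
    (hlawX : μ.map X = volume.withDensity (fun z => ENNReal.ofReal (gammaDen m (1 / m) z)))
    (hlawY : μ.map Y = volume.withDensity (fun z => ENNReal.ofReal (gammaDen m (1 / m) z))) :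
    ∃ C > 0, ∀ t, 0 ≤ t → μ.real {ω | t ^ 2 < X ω * Y ω} ≤ C * Real.exp (-(2 * s * t)) := by
  have hm : 0 < m := hs0.trans_lt hs
  have hint := hindep.integrable_exp_mul_add (integrable_exp_mul_of_gammaLaw hm hs hX hlawX)
    (integrable_exp_mul_of_gammaLaw hm hs hY hlawY)
  refine ⟨mgf (X + Y) μ s, mgf_pos hint, fun t ht => ?_⟩
  calc μ.real {ω | t ^ 2 < X ω * Y ω}
      ≤ μ.real {ω | 2 * t ≤ (X + Y) ω} := by
        refine ENNReal.toReal_mono (measure_ne_top _ _) (measure_mono_ae ?_)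
        filter_upwards [ae_pos_of_gammaLaw hX hlawX, ae_pos_of_gammaLaw hY hlawY] with ω hx hy h
        change t ^ 2 < X ω * Y ω at h
        change 2 * t ≤ X ω + Y ω
        refine (sq_le_sq₀ (by positivity) (by positivity)).1 ?_
        nlinarith [sq_nonneg (X ω - Y ω)]
    _ ≤ Real.exp (-s * (2 * t)) * mgf (X + Y) μ s := measure_ge_le_exp_mul_mgf _ hs0 hint
    _ = mgf (X + Y) μ s * Real.exp (-(2 * s * t)) := by
        rw [mul_comm]
        congr 2
        ring

theorem exists_le_tail_mul_of_gammaLaw {X Y : Ω → ℝ} {a : ℝ} (hm : 0 < m) (ha : m < a)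
    (hX : Measurable X) (hY : Measurable Y) (hindep : IndepFun X Y μ)
    (hlawX : μ.map X = volume.withDensity (fun z => ENNReal.ofReal (gammaDen m (1 / m) z)))
    (hlawY : μ.map Y = volume.withDensity (fun z => ENNReal.ofReal (gammaDen m (1 / m) z))) :
    ∃ c > 0, ∀ t, 1 ≤ t → c * Real.exp (-(2 * a * t)) ≤ μ.real {ω | t ^ 2 < X ω * Y ω} := by
  obtain ⟨c, hc, hle⟩ := exists_exp_le_tail_of_gammaLaw (μ := μ) hm ha
  refine ⟨c ^ 2, by positivity, fun t ht => ?_⟩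
  have hinter : μ.real ({ω | t < X ω} ∩ {ω | t < Y ω}) =
      μ.real {ω | t < X ω} * μ.real {ω | t < Y ω} := by
    simp only [measureReal_def, ← ENNReal.toReal_mul]
    congr 1
    exact hindep.measure_inter_preimage_eq_mul (Ioi t) (Ioi t) measurableSet_Ioi measurableSet_Ioi
  calc c ^ 2 * Real.exp (-(2 * a * t))
      = c * Real.exp (-(a * t)) * (c * Real.exp (-(a * t))) := by
        rw [mul_mul_mul_comm, ← Real.exp_add, sq]
        congr 2
        ring
    _ ≤ μ.real {ω | t < X ω} * μ.real {ω | t < Y ω} :=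
        mul_le_mul (hle X hX hlawX t ht) (hle Y hY hlawY t ht) (by positivity) measureReal_nonneg
    _ = μ.real ({ω | t < X ω} ∩ {ω | t < Y ω}) := hinter.symm
    _ ≤ μ.real {ω | t ^ 2 < X ω * Y ω} := by
        refine measureReal_mono fun ω hω => ?_
        have hx : t < X ω := hω.1
        have hy : t < Y ω := hω.2
        change t ^ 2 < X ω * Y ω
        nlinarith

end GammaLaw

/-- Tail-distribution comparison (Section III of the paper): for mean-normalized
double-Gamma (double-Nakagami-m) channel gains, higher fading severity (smaller shape `m`)
puts asymptotically more probability mass in the tail: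
`P(XY > γ)/P(X'Y' > γ) → ∞` as `γ → ∞` when `1/2 ≤ m < m'`. -/
theorem dyadic_tail_comparison
    {Ωs : Type*} [MeasureSpace Ωs] [IsProbabilityMeasure (ℙ : Measure Ωs)]
    (m m' : ℝ) (hm : 1 / 2 ≤ m) (hmm' : m < m')
    (X Y X' Y' : Ωs → ℝ)
    (hX : Measurable X) (hY : Measurable Y) (hX' : Measurable X') (hY' : Measurable Y')
    (hindep : IndepFun X Y) (hindep' : IndepFun X' Y')
    (hlawX : Measure.map X ℙ =
      volume.withDensity (fun z => ENNReal.ofReal (gammaDen m (1 / m) z)))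
    (hlawY : Measure.map Y ℙ =
      volume.withDensity (fun z => ENNReal.ofReal (gammaDen m (1 / m) z)))
    (hlawX' : Measure.map X' ℙ =
      volume.withDensity (fun z => ENNReal.ofReal (gammaDen m' (1 / m') z)))
    (hlawY' : Measure.map Y' ℙ =
      volume.withDensity (fun z => ENNReal.ofReal (gammaDen m' (1 / m') z))) :
    Tendsto (fun γ : ℝ =>
        (ℙ {ω | γ < X ω * Y ω}).toReal / (ℙ {ω | γ < X' ω * Y' ω}).toReal)
      atTop atTop := by
  have hm0 : 0 < m := by linarith
  have hm0' : 0 < m' := by linarith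
  obtain ⟨a, hma, ham'⟩ := exists_between hmm'
  obtain ⟨s, has, hsm'⟩ := exists_between ham'
  obtain ⟨c, hc, hlow⟩ := exists_le_tail_mul_of_gammaLaw hm0 hma hX hY hindep hlawX hlawY
  obtain ⟨c', hc', hlow'⟩ :=
    exists_le_tail_mul_of_gammaLaw hm0' (lt_add_one m') hX' hY' hindep' hlawX' hlawY'
  obtain ⟨C, hC, hup⟩ :=
    exists_tail_mul_le_of_gammaLaw (by linarith) hsm' hX' hY' hindep' hlawX' hlawY'
  have hexp : Tendsto (fun γ : ℝ => c / C * Real.exp (2 * (s - a) * √γ)) atTop atTop :=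
    (Real.tendsto_exp_atTop.comp
      (Real.tendsto_sqrt_atTop.const_mul_atTop (by linarith))).const_mul_atTop (by positivity)
  refine tendsto_atTop_mono' _ ?_ hexp
  filter_upwards [eventually_ge_atTop (1 : ℝ)] with γ hγ
  have ht : 1 ≤ √γ := Real.one_le_sqrt.2 hγ
  have hsq : √γ ^ 2 = γ := Real.sq_sqrt (by linarith)
  have hnum := hlow _ ht
  have hden := hup √γ (by linarith)
  have hpos := (by positivity : 0 < c' * Real.exp (-(2 * (m' + 1) * √γ))).trans_le (hlow' _ ht)
  rw [hsq] at hnum hden hpos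
  calc c / C * Real.exp (2 * (s - a) * √γ)
      = c * Real.exp (-(2 * a * √γ)) / (C * Real.exp (-(2 * s * √γ))) := by
        rw [mul_div_mul_comm, ← Real.exp_sub]
        congr 2
        ring
    _ ≤ _ := div_le_div₀ measureReal_nonneg hnum hpos hden
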